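/- Consider sampling without replacement from a population of N units of which M have a certain attribute, with indicator variables X_1, …, X_n having the joint distribution Pr{X_i = x_i, i = 1,…,n} = C(M, Σx_i)·C(N−M, n−Σx_i) / (C(n, Σx_i)·C(N, n)), and let p = M/N ∈ (0,1). Then Pr{ (Σ_{i=1}^{n} X_i)/n ≥ z } ≤ exp( n·𝓜_B(z, p) ) for all z with p ≤ z ≤ 1, and Pr{ (Σ_{i=1}^{n} X_i)/n ≤ z } ≤ exp( n·𝓜_B(z, p) ) for all z with 0 ≤ z ≤ p. -/

import Mathlib

open MeasureTheory ProbabilityTheory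

/-- `𝓜_B(z, μ) = z ln(μ/z) + (1-z) ln((1-μ)/(1-z))`; with the Lean conventions
`x / 0 = 0` and `log 0 = 0` this gives `𝓜_B(1, μ) = ln μ` and `𝓜_B(0, μ) = ln (1-μ)`. -/
noncomputable def McalB (z μ : ℝ) : ℝ :=
  z * Real.log (μ / z) + (1 - z) * Real.log ((1 - μ) / (1 - z))


lemma hb_desc (M N : ℕ) (h : M ≤ N) (j : ℕ) :
    M.descFactorial j * N ^ j ≤ N.descFactorial j * M ^ j := by
  induction j with
  | zero => simp
  | succ j ih =>
    rw [Nat.descFactorial_succ, Nat.descFactorial_succ, pow_succ, pow_succ]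
    have h1 : (M - j) * N ≤ (N - j) * M := by
      rcases le_total M j with hj | hj
      · simp [Nat.sub_eq_zero_of_le hj]
      · obtain ⟨a, rfl⟩ := Nat.exists_eq_add_of_le hj
        obtain ⟨b, rfl⟩ := Nat.exists_eq_add_of_le h
        have e1 : j + a - j = a := by omega
        have e2 : j + a + b - j = a + b := by omega
        rw [e1, e2]
        nlinarith [Nat.zero_le (b * j)]
    calc (M - j) * M.descFactorial j * (N ^ j * N)
        = (M.descFactorial j * N ^ j) * ((M - j) * N) := by ring
      _ ≤ (N.descFactorial j * M ^ j) * ((N - j) * M) := Nat.mul_le_mul ih h1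
      _ = _ := by ring

lemma hb_choose (M N : ℕ) (h : M ≤ N) (j : ℕ) :
    M.choose j * N ^ j ≤ N.choose j * M ^ j := by
  have := hb_desc M N h j
  rw [Nat.descFactorial_eq_factorial_mul_choose, Nat.descFactorial_eq_factorial_mul_choose,
    mul_assoc, mul_assoc] at this
  exact Nat.le_of_mul_le_mul_left this (Nat.factorial_pos j)

open Polynomial in
lemma hb_gen (M L n : ℕ) (s : ℝ) :
    ∑ k ∈ Finset.range (n + 1), (M.choose k : ℝ) * (L.choose (n - k)) * (1 + s) ^ k
      = ∑ j ∈ Finset.range (M + 1), (M.choose j : ℝ) * s ^ j *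
          (if j ≤ n then ((M + L - j).choose (n - j) : ℝ) else 0) := by
  have key : ((1 + C (1 + s) * X) ^ M * (1 + X) ^ L : ℝ[X])
      = ∑ j ∈ Finset.range (M + 1), C ((M.choose j : ℝ) * s ^ j) * ((1 + X) ^ (M + L - j) * X ^ j) := by
    have : (1 + C (1 + s) * X : ℝ[X]) = C s * X + (1 + X) := by
      simp only [C_add, C_1]; ring
    rw [this, add_pow, Finset.sum_mul]
    refine Finset.sum_congr rfl fun j hj => ?_
    have hj' : j ≤ M := by simpa [Nat.lt_succ_iff] using hj
    have : M + L - j = (M - j) + L := by omega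
    rw [this, pow_add]
    simp only [C_mul, C_pow, mul_pow, map_natCast]
    ring
  have h := congrArg (fun q => coeff q n) key
  simp only [finsetSum_coeff, coeff_C_mul, coeff_mul_X_pow', coeff_one_add_X_pow] at h
  rw [coeff_mul, Finset.Nat.sum_antidiagonal_eq_sum_range_succ_mk] at h
  rw [← h]
  refine Finset.sum_congr rfl fun k hk => ?_
  have h2 : (1 + C (1 + s) * X : ℝ[X]) ^ M = ((1 + X) ^ M : ℝ[X]).comp (C (1 + s) * X) := by
    simp
  rw [coeff_one_add_X_pow, h2, comp_C_mul_X_coeff, coeff_one_add_X_pow]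
  ring

lemma hb_mgf (M L n : ℕ) (hn : n ≤ M + L) (hN : 0 < M + L) (s : ℝ) (hs : 0 ≤ s) :
    ∑ k ∈ Finset.range (n + 1), (M.choose k : ℝ) * (L.choose (n - k)) * (1 + s) ^ k
      ≤ (M + L).choose n * (1 + (M : ℝ) / ((M + L : ℕ) : ℝ) * s) ^ n := by
  have hNR : (0 : ℝ) < ((M + L : ℕ) : ℝ) := by exact_mod_cast hN
  have hterm : ∀ j ≤ n, (M.choose j : ℝ) * s ^ j * ((M + L - j).choose (n - j) : ℝ)
      ≤ (M + L).choose n * ((n.choose j : ℝ) * ((M : ℝ) / ((M + L : ℕ) : ℝ) * s) ^ j) := by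
    intro j hj
    have h1 : ((M.choose j : ℝ)) ≤ (M + L).choose j * ((M : ℝ) / ((M + L : ℕ) : ℝ)) ^ j := by
      rw [div_pow, ← mul_div_assoc, le_div_iff₀ (by positivity)]
      exact_mod_cast hb_choose M (M + L) (by omega) j
    have h2 : ((M + L).choose n : ℝ) * (n.choose j : ℝ)
        = (M + L).choose j * (M + L - j).choose (n - j) := by
      exact_mod_cast Nat.choose_mul hj
    rw [← mul_assoc, h2, mul_pow]
    calc (M.choose j : ℝ) * s ^ j * ((M + L - j).choose (n - j) : ℝ)
        ≤ ((M + L).choose j * ((M : ℝ) / ((M + L : ℕ) : ℝ)) ^ j) * s ^ j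
            * ((M + L - j).choose (n - j) : ℝ) := by gcongr
      _ = _ := by ring
  rw [hb_gen, add_comm (1 : ℝ), add_pow, Finset.mul_sum]
  rw [← Finset.sum_subset (s₁ := (Finset.range (M + 1)).filter (· ≤ n)) (Finset.filter_subset _ _)]
  · rw [Finset.sum_filter]
    rw [← Finset.sum_filter]
    refine (Finset.sum_le_sum (g := fun j => ((M + L).choose n : ℝ) *
      ((n.choose j : ℝ) * ((M : ℝ) / ((M + L : ℕ) : ℝ) * s) ^ j)) ?_).trans ?_
    · intro j hj
      have hj2 := (Finset.mem_filter.mp hj).2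
      rw [if_pos hj2]
      exact hterm j hj2
    · refine (Finset.sum_le_sum_of_subset_of_nonneg (t := Finset.range (n + 1)) ?_ ?_).trans ?_
      · intro j hj
        have hj2 := (Finset.mem_filter.mp hj).2
        simp; omega
      · intros; positivity
      · refine Finset.sum_le_sum fun j _ => le_of_eq ?_
        rw [one_pow]; ring
  · intro j hj hj'
    have : ¬ j ≤ n := fun h => hj' (Finset.mem_filter.mpr ⟨hj, h⟩)
    simp [this]

lemma hb_exp (p z : ℝ) (n : ℕ) (hp0 : 0 < p) (hp1 : p < 1) (hz : p ≤ z) (hz1 : z < 1) :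
    ∃ s : ℝ, 0 ≤ s ∧ (1 + p * s) ^ n * (1 + s) ^ (-(n * z)) = Real.exp (n * McalB z p) := by
  have hz0 : 0 < z := by linarith
  have hq : 0 < 1 - p := by linarith
  have hw : 0 < 1 - z := by linarith
  refine ⟨(z - p) / (p * (1 - z)), div_nonneg (by linarith) (by positivity), ?_⟩
  have e1 : 1 + p * ((z - p) / (p * (1 - z))) = (1 - p) / (1 - z) := by
    field_simp; ring
  have e2 : 1 + (z - p) / (p * (1 - z)) = ((1 - p) / (1 - z)) / (p / z) := by
    field_simp; ring
  have ha : 0 < (1 - p) / (1 - z) := by positivity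
  have hb : 0 < p / z := by positivity
  rw [e1, e2, Real.rpow_def_of_pos (by positivity), Real.log_div ha.ne' hb.ne',
    ← Real.rpow_natCast, Real.rpow_def_of_pos ha, ← Real.exp_add, McalB]
  congr 1
  ring

/-- probability weight of a fixed pattern with `k` ones -/
noncomputable def hbW (M L n k : ℕ) : ℝ :=
  ((M.choose k * L.choose (n - k) : ℕ) : ℝ) / ((n.choose k * (M + L).choose n : ℕ) : ℝ)

lemma hb_sum (M L n : ℕ) (hn : 0 < n) (hnN : n ≤ M + L)
    (p : ℝ) (hp : p = (M : ℝ) / ((M + L : ℕ) : ℝ)) (hp0 : 0 < p) (hp1 : p < 1)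
    (z : ℝ) (hz : p ≤ z) (hz1 : z ≤ 1) :
    ∑ T ∈ (Finset.range n).powerset.filter (fun T => n * z ≤ (T.card : ℝ)), hbW M L n T.card
      ≤ Real.exp (n * McalB z p) := by
  have hW : ∀ k, 0 ≤ hbW M L n k := fun k => by unfold hbW; positivity
  have hC : (0 : ℝ) < (M + L).choose n := by exact_mod_cast Nat.choose_pos hnN
  rcases hz1.lt_or_eq with hlt | rfl
  · obtain ⟨s, hs, he⟩ := hb_exp p z n hp0 hp1 hz hlt
    rw [← he]
    calc ∑ T ∈ (Finset.range n).powerset.filter (fun T => n * z ≤ (T.card : ℝ)), hbW M L n T.card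
        ≤ ∑ T ∈ (Finset.range n).powerset.filter (fun T => n * z ≤ (T.card : ℝ)),
            hbW M L n T.card * (1 + s) ^ T.card * (1 + s) ^ (-(n * z)) := by
          refine Finset.sum_le_sum fun T hT => ?_
          have h := (Finset.mem_filter.mp hT).2
          rw [mul_assoc, ← Real.rpow_natCast, ← Real.rpow_add (by linarith)]
          refine le_mul_of_one_le_right (hW _) (Real.one_le_rpow (by linarith) (by linarith))
      _ ≤ ∑ T ∈ (Finset.range n).powerset,
            hbW M L n T.card * (1 + s) ^ T.card * (1 + s) ^ (-(n * z)) := by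
          refine Finset.sum_le_sum_of_subset_of_nonneg (Finset.filter_subset _ _) ?_
          intro T _ _
          have := hW T.card
          positivity
      _ = (∑ k ∈ Finset.range (n + 1), (M.choose k : ℝ) * (L.choose (n - k)) * (1 + s) ^ k)
            / (M + L).choose n * (1 + s) ^ (-(n * z)) := by
          rw [← Finset.sum_mul, Finset.sum_powerset_apply_card (fun k => hbW M L n k * (1 + s) ^ k),
            Finset.sum_div]
          congr 1
          rw [Finset.card_range]
          refine Finset.sum_congr rfl fun k hk => ?_
          have hk' : k ≤ n := by simpa [Nat.lt_succ_iff] using hk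
          have : (0 : ℝ) < n.choose k := by exact_mod_cast Nat.choose_pos hk'
          unfold hbW
          push_cast
          rw [nsmul_eq_mul]
          field_simp
      _ ≤ _ := by
          gcongr
          rw [div_le_iff₀ hC, mul_comm, hp]
          exact hb_mgf M L n hnN (by omega) s hs
  · have : (Finset.range n).powerset.filter (fun T => n * (1 : ℝ) ≤ (T.card : ℝ))
        ⊆ {Finset.range n} := by
      intro T hT
      obtain ⟨h1, h2⟩ := Finset.mem_filter.mp hT
      rw [mul_one] at h2
      have h2' : n ≤ T.card := by exact_mod_cast h2
      rw [Finset.mem_singleton]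
      exact Finset.eq_of_subset_of_card_le (Finset.mem_powerset.mp h1) (by simpa using h2')
    refine (Finset.sum_le_sum_of_subset_of_nonneg this (fun _ _ _ => hW _)).trans ?_
    have e : Real.exp (n * McalB 1 p) = p ^ n := by
      simp only [McalB, div_one, one_mul, sub_self, zero_mul, add_zero]
      rw [Real.exp_nat_mul, Real.exp_log hp0]
    rw [e, Finset.sum_singleton, Finset.card_range, hbW]
    have hNR : (0 : ℝ) < ((M + L : ℕ) : ℝ) := by exact_mod_cast (by omega : 0 < M + L)
    simp only [Nat.sub_self, Nat.choose_zero_right, mul_one, Nat.choose_self, one_mul]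
    rw [div_le_iff₀ hC, hp, div_pow, div_mul_eq_mul_div, le_div_iff₀ (by positivity)]
    have := hb_choose M (M + L) (by omega) n
    rw [mul_comm (_ ^ n)  (((M + L).choose n : ℕ) : ℝ)]
    exact_mod_cast this

lemma hb_upper {Ω : Type*} [MeasurableSpace Ω] (P : Measure Ω) 
    (M L n : ℕ) (hn : 0 < n) (hnN : n ≤ M + L)
    (X : ℕ → Ω → ℝ) (h01 : ∀ i ω, X i ω = 0 ∨ X i ω = 1)
    (hj : ∀ T ⊆ Finset.range n,
      P {ω | ∀ i < n, X i ω = if i ∈ T then 1 else 0} = ENNReal.ofReal (hbW M L n T.card))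
    (p : ℝ) (hp : p = (M : ℝ) / ((M + L : ℕ) : ℝ)) (hp0 : 0 < p) (hp1 : p < 1)
    (z : ℝ) (hz : p ≤ z) (hz1 : z ≤ 1) :
    P {ω | z ≤ (∑ i ∈ Finset.range n, X i ω) / n}
        ≤ ENNReal.ofReal (Real.exp (n * McalB z p)) := by
  classical
  have hsub : {ω | z ≤ (∑ i ∈ Finset.range n, X i ω) / n} ⊆
      ⋃ T ∈ (Finset.range n).powerset.filter (fun T => n * z ≤ (T.card : ℝ)),
        {ω | ∀ i < n, X i ω = if i ∈ T then 1 else 0} := by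
    intro ω hω
    have hX : ∀ i < n, X i ω = if i ∈ (Finset.range n).filter (fun i => X i ω = 1) then 1 else 0 := by
      intro i hi
      rcases h01 i ω with h | h <;> simp [h, hi]
    have hsum : ∑ i ∈ Finset.range n, X i ω
        = (((Finset.range n).filter (fun i => X i ω = 1)).card : ℝ) := by
      rw [Finset.card_filter]
      push_cast
      refine Finset.sum_congr rfl fun i _ => ?_
      rcases h01 i ω with h | h <;> simp [h]
    simp only [Set.mem_iUnion]
    refine ⟨(Finset.range n).filter (fun i => X i ω = 1), ?_, hX⟩
    rw [Finset.mem_filter]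
    refine ⟨Finset.mem_powerset.mpr (Finset.filter_subset _ _), ?_⟩
    rw [← hsum]
    have hnR : (0 : ℝ) < n := by exact_mod_cast hn
    have := (le_div_iff₀ hnR).mp hω
    linarith
  refine (measure_mono hsub).trans ((measure_biUnion_finset_le _ _).trans ?_)
  rw [Finset.sum_congr rfl (fun T hT => hj T (Finset.mem_powerset.mp (Finset.mem_filter.mp hT).1)),
    ← ENNReal.ofReal_sum_of_nonneg (fun T _ => by unfold hbW; positivity)]
  exact ENNReal.ofReal_le_ofReal (hb_sum M L n hn hnN p hp hp0 hp1 z hz hz1)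

theorem hoeffding_bound_sampling_without_replacement
    {Ω : Type*} [MeasurableSpace Ω] (P : Measure Ω) [IsProbabilityMeasure P]
    (N M : ℕ) (hMN : M ≤ N) (hN : 0 < N)
    (X : ℕ → Ω → ℝ) (n : ℕ) (hn : 0 < n) (hnN : n ≤ N)
    (hmeas : ∀ i, Measurable (X i))
    (h01 : ∀ i ω, X i ω = 0 ∨ X i ω = 1)
    (hjoint : ∀ m : ℕ, m ≤ n → ∀ x : ℕ → ℕ, (∀ i, x i ≤ 1) →
      P {ω | ∀ i < m, X i ω = (x i : ℝ)}
        = ENNReal.ofReal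
            (((M.choose (∑ i ∈ Finset.range m, x i)
                * (N - M).choose (m - ∑ i ∈ Finset.range m, x i) : ℕ) : ℝ)
              / ((m.choose (∑ i ∈ Finset.range m, x i) * N.choose m : ℕ) : ℝ)))
    (p : ℝ) (hp : p = (M : ℝ) / N) (hp0 : 0 < p) (hp1 : p < 1) :
    (∀ z : ℝ, p ≤ z → z ≤ 1 →
      P {ω | z ≤ (∑ i ∈ Finset.range n, X i ω) / n}
        ≤ ENNReal.ofReal (Real.exp (n * McalB z p))) ∧
    (∀ z : ℝ, 0 ≤ z → z ≤ p →
      P {ω | (∑ i ∈ Finset.range n, X i ω) / n ≤ z}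
        ≤ ENNReal.ofReal (Real.exp (n * McalB z p))) := by
  classical
  obtain ⟨L, rfl⟩ := Nat.exists_eq_add_of_le hMN
  have hNR : (0 : ℝ) < ((M + L : ℕ) : ℝ) := by exact_mod_cast hN
  have hj : ∀ T ⊆ Finset.range n,
      P {ω | ∀ i < n, X i ω = if i ∈ T then 1 else 0} = ENNReal.ofReal (hbW M L n T.card) := by
    intro T hT
    have h := hjoint n le_rfl (fun i => if i ∈ T then 1 else 0)
      (fun i => by split_ifs <;> simp)
    have hs : (∑ i ∈ Finset.range n, if i ∈ T then 1 else 0) = T.card := by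
      rw [← Finset.card_filter, Finset.filter_mem_eq_inter, Finset.inter_eq_right.mpr hT]
    simp only [hs, Nat.add_sub_cancel_left] at h
    rw [hbW, ← h]
    congr 1
    ext ω
    simp
  refine ⟨fun z hz hz1 => hb_upper P M L n hn hnN X h01 hj p hp hp0 hp1 z hz hz1, ?_⟩
  intro z hz0 hzp
  have hj' : ∀ T ⊆ Finset.range n,
      P {ω | ∀ i < n, 1 - X i ω = if i ∈ T then 1 else 0} = ENNReal.ofReal (hbW L M n T.card) := by
    intro T hT
    have h := hj (Finset.range n \ T) Finset.sdiff_subset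
    have hc : (Finset.range n \ T).card = n - T.card := by
      rw [Finset.card_sdiff_of_subset hT, Finset.card_range]
    have hTn : T.card ≤ n := by simpa using Finset.card_le_card hT
    have hw : hbW M L n (n - T.card) = hbW L M n T.card := by
      unfold hbW
      rw [Nat.sub_sub_self hTn, Nat.choose_symm hTn, mul_comm (M.choose _), add_comm M L]
    rw [hc, hw] at h
    rw [← h]
    congr 1
    ext ω
    refine forall₂_congr fun i hi => ?_
    by_cases hiT : i ∈ T
    · simp [hiT, sub_eq_iff_eq_add]
    · simp only [hiT, Finset.mem_sdiff, Finset.mem_range, hi]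
      simp only [not_false_eq_true, and_self, if_true, if_false, Bool.false_eq_true]
      constructor <;> intro h <;> linarith
  have h := hb_upper P L M n hn (by omega) (fun i ω => 1 - X i ω)
    (fun i ω => by rcases h01 i ω with h | h <;> simp [h]) hj' (1 - p)
    (by rw [hp, add_comm L M]; field_simp; push_cast; ring) (by linarith) (by linarith)
    (1 - z) (by linarith) (by linarith)
  have hM : McalB (1 - z) (1 - p) = McalB z p := by
    simp only [McalB, sub_sub_cancel]; ring
  rw [hM] at h
  convert h using 3
  ext ω
  have hnR : (n : ℝ) ≠ 0 := by exact_mod_cast hn.ne'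
  simp only [Finset.sum_sub_distrib, Finset.sum_const, Finset.card_range, nsmul_eq_mul, mul_one,
    sub_div, div_self hnR]
  constructor <;> intro h <;> linarith
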